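/- Let H be an m×n real matrix with full column rank and let S be an (algebraic) observability set. Then any two vectors c, c' ∈ ℝⁿ with c ≠ 0, support(H·c) ⊆ S and support(H·c') ⊆ S are linearly dependent; i.e., the stealthy attack supported inside an observability set is unique up to a scalar multiple. -/

import Mathlib

/-- The submatrix of `H` obtained by deleting the rows indexed by `S`. -/
def delRows {m n : ℕ} (H : Matrix (Fin m) (Fin n) ℝ) (S : Set (Fin m)) :
    Matrix {i : Fin m // i ∉ S} (Fin n) ℝ :=
  Matrix.of fun i j => H i.1 j

theorem Matrix.mulVec_injective_of_rank_eq_card {ι κ K : Type*} [Field K] [Fintype κ]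
    {A : Matrix ι κ K} (hA : A.rank = Fintype.card κ) : Function.Injective A.mulVec := by
  rw [Matrix.mulVec_injective_iff, linearIndependent_iff_card_eq_finrank_span, Set.finrank,
    ← Matrix.rank_eq_finrank_span_cols, hA]

theorem delRows_mulVec_eq_zero_iff {m n : ℕ} (H : Matrix (Fin m) (Fin n) ℝ) (S : Set (Fin m))
    (c : Fin n → ℝ) : (delRows H S).mulVec c = 0 ↔ Function.support (H.mulVec c) ⊆ S := by
  rw [Function.support_subset_iff', funext_iff]
  exact Subtype.forall

/-- For `H` of full column rank and `S` an (algebraic) observability set, any two vectors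
`c, c'` with `c ≠ 0` whose stealthy attacks `H·c` and `H·c'` are supported inside `S` are
linearly dependent: the stealthy attack supported inside an observability set is unique up
to a scalar multiple. -/
theorem stealthy_attack_in_observability_set_unique_up_to_scalar
    {m n : ℕ} (H : Matrix (Fin m) (Fin n) ℝ) (hH : H.rank = n) (S : Set (Fin m))
    (hker : ∃ c : Fin n → ℝ, c ≠ 0 ∧ (delRows H S).mulVec c = 0)
    (hmin : ∀ k ∈ S, ∀ c : Fin n → ℝ, (delRows H (S \ {k})).mulVec c = 0 → c = 0)
    (c c' : Fin n → ℝ) (hc : c ≠ 0)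
    (hsc : Function.support (H.mulVec c) ⊆ S)
    (hsc' : Function.support (H.mulVec c') ⊆ S) :
    ∃ α : ℝ, c' = α • c := by
  have hHc : H.mulVec c ≠ 0 := fun h =>
    hc (Matrix.mulVec_injective_of_rank_eq_card (by simpa using hH) (by simpa using h))
  obtain ⟨k, hk⟩ := Function.ne_iff.mp hHc
  refine ⟨H.mulVec c' k / H.mulVec c k, sub_eq_zero.mp (hmin k (hsc hk) _ ?_)⟩
  rw [delRows_mulVec_eq_zero_iff, Function.support_subset_iff']
  intro i hi
  simp only [Matrix.mulVec_sub, Matrix.mulVec_smul, Pi.sub_apply, Pi.smul_apply, smul_eq_mul]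
  by_cases hiS : i ∈ S
  · obtain rfl : i = k := by_contra fun hik => hi ⟨hiS, hik⟩
    rw [div_mul_cancel₀ _ hk, sub_self]
  · rw [Function.support_subset_iff'.mp hsc i hiS, Function.support_subset_iff'.mp hsc' i hiS,
      mul_zero, sub_self]
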